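/- arXiv:1812.03565 — 7 statements merged into one kernel-verified Lean document; each statement's English description precedes it below -/
import Mathlib

section
/- Let A be an n×n real matrix satisfying ‖A^k‖ ≤ C ρ^k (operator norm) for all integers k ≥ 0, where C > 0 and ρ ∈ (0,1). Fix γ ∈ (ρ, 1) and let Δ be an n×n matrix with ‖Δ‖ ≤ (γ − ρ)/C. Then (a) ‖(A+Δ)^k‖ ≤ C γ^k for all k ≥ 0, and (b) the spectral radius of A+Δ is at most γ (in particular A+Δ is stable). -/
open Matrix

/-- The operator (spectral) norm of a square real matrix, i.e. the norm of the
induced linear map on Euclidean space. -/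
noncomputable def opNorm {n : ℕ} (A : Matrix (Fin n) (Fin n) ℝ) : ℝ :=
  ‖Matrix.toEuclideanCLM (𝕜 := ℝ) A‖

/-- Geometric decay of the powers of `a` survives a small perturbation `d`, at a slower rate. -/
theorem norm_pow_mul_add_pow_le {R : Type*} [SeminormedRing R] {a d : R} {C ρ γ : ℝ}
    (hC : 0 < C) (hργ : ρ ≤ γ) (hρ : 0 ≤ ρ) (ha : ∀ k : ℕ, ‖a ^ k‖ ≤ C * ρ ^ k)
    (hd : ‖d‖ ≤ (γ - ρ) / C) (k j : ℕ) :
    ‖a ^ j * (a + d) ^ k‖ ≤ C * ρ ^ j * γ ^ k := by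
  induction k generalizing j with
  | zero => simpa using ha j
  | succ k ih =>
    have hγ : 0 ≤ γ := hρ.trans hργ
    have hk : ‖(a + d) ^ k‖ ≤ C * γ ^ k := by simpa using ih 0
    have hsub : 0 ≤ (γ - ρ) / C := div_nonneg (sub_nonneg.2 hργ) hC.le
    calc ‖a ^ j * (a + d) ^ (k + 1)‖
        = ‖a ^ (j + 1) * (a + d) ^ k + a ^ j * d * (a + d) ^ k‖ := by
          rw [pow_succ' (a + d), pow_succ a]; congr 1; noncomm_ring
      _ ≤ ‖a ^ (j + 1) * (a + d) ^ k‖ + ‖a ^ j‖ * ‖d‖ * ‖(a + d) ^ k‖ :=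
          (norm_add_le _ _).trans (by gcongr; exact norm_mul₃_le ..)
      _ ≤ C * ρ ^ (j + 1) * γ ^ k + C * ρ ^ j * ((γ - ρ) / C) * (C * γ ^ k) := by
          gcongr
          exacts [ih _, ha j]
      _ = C * ρ ^ j * γ ^ (k + 1) := by field_simp; ring

/-- If the powers of `a` are `O(γ ^ k)`, then the spectral radius of `a` is at most `γ`. -/
theorem spectralRadius_le_of_norm_pow_le {R : Type*} [NormedRing R] [NormedAlgebra ℂ R]
    [CompleteSpace R] {a : R} {K γ : ℝ} (hγ : 0 < γ) (ha : ∀ k : ℕ, ‖a ^ k‖ ≤ K * γ ^ k) :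
    spectralRadius ℂ a ≤ ENNReal.ofReal γ := by
  refine iSup₂_le fun μ hμ => ?_
  rw [← enorm_eq_nnnorm, ← ofReal_norm]
  refine ENNReal.ofReal_le_ofReal ?_
  by_contra! hlt
  obtain ⟨k, hk⟩ := pow_unbounded_of_one_lt (K * ‖(1 : R)‖) ((one_lt_div hγ).2 hlt)
  have hle : ‖μ‖ ^ k ≤ K * γ ^ k * ‖(1 : R)‖ := by
    rw [← norm_pow]
    exact (spectrum.norm_le_norm_mul_of_mem (spectrum.pow_mem_pow a k hμ)).trans
      (by gcongr; exact ha k)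
  rw [div_pow, lt_div_iff₀ (pow_pos hγ k)] at hk
  linarith

theorem LinearMap.exists_norm_le_mul_norm {E F : Type*} [NormedAddCommGroup E] [NormedSpace ℝ E]
    [FiniteDimensional ℝ E] [SeminormedAddCommGroup F] [NormedSpace ℝ F] (L : E →ₗ[ℝ] F) :
    ∃ K : ℝ, 0 ≤ K ∧ ∀ x, ‖L x‖ ≤ K * ‖x‖ :=
  ⟨‖L.toContinuousLinearMap‖, norm_nonneg _, L.toContinuousLinearMap.le_opNorm⟩

/-- If the powers of a real matrix are `O(γ ^ k)`, then its complex eigenvalues have modulus at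
most `γ`. -/
theorem spectralRadius_map_ofReal_le {n : ℕ} {B : Matrix (Fin n) (Fin n) ℝ} {C γ : ℝ}
    (hγ : 0 < γ) (hB : ∀ k : ℕ, opNorm (B ^ k) ≤ C * γ ^ k) :
    spectralRadius ℂ (B.map Complex.ofReal) ≤ ENNReal.ofReal γ := by
  let _ : NormedRing (Matrix (Fin n) (Fin n) ℂ) := Matrix.linftyOpNormedRing
  let _ : NormedAlgebra ℂ (Matrix (Fin n) (Fin n) ℂ) := Matrix.linftyOpNormedAlgebra
  let _ : NormedAlgebra ℝ (Matrix (Fin n) (Fin n) ℂ) := Matrix.linftyOpNormedAlgebra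
  let e := Matrix.toEuclideanCLM (n := Fin n) (𝕜 := ℝ)
  let L : (EuclideanSpace ℝ (Fin n) →L[ℝ] EuclideanSpace ℝ (Fin n)) →ₗ[ℝ]
      Matrix (Fin n) (Fin n) ℂ :=
    Complex.ofRealCLM.toLinearMap.mapMatrix ∘ₗ e.symm.toAlgEquiv.toLinearMap
  obtain ⟨K, hK, hL⟩ := L.exists_norm_le_mul_norm
  have hLe (M : Matrix (Fin n) (Fin n) ℝ) : L (e M) = M.map Complex.ofReal := by
    change (e.symm (e M)).map Complex.ofReal = _
    rw [e.symm_apply_apply]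
  refine spectralRadius_le_of_norm_pow_le (K := K * C) hγ fun k => ?_
  have hpow : B.map Complex.ofReal ^ k = (B ^ k).map Complex.ofReal :=
    (map_pow (Complex.ofRealHom.mapMatrix (m := Fin n)) B k).symm
  rw [hpow, ← hLe, mul_assoc]
  exact (hL _).trans (mul_le_mul_of_nonneg_left (hB k) hK)

/-- **Stability perturbation bound.**  If `‖A^k‖ ≤ C ρ^k` for all `k ≥ 0` with `C > 0`,
`ρ ∈ (0,1)`, `γ ∈ (ρ,1)` and `‖Δ‖ ≤ (γ − ρ)/C`, then (a) `‖(A+Δ)^k‖ ≤ C γ^k` for all `k`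
and (b) the spectral radius of `A + Δ` (maximum modulus of its complex eigenvalues)
is at most `γ`; in particular `A + Δ` is stable. -/
theorem stability_perturbation {n : ℕ} (A Δ : Matrix (Fin n) (Fin n) ℝ)
    (C ρ γ : ℝ) (hC : 0 < C) (hρ : ρ ∈ Set.Ioo (0 : ℝ) 1) (hγ : γ ∈ Set.Ioo ρ 1)
    (hA : ∀ k : ℕ, opNorm (A ^ k) ≤ C * ρ ^ k)
    (hΔ : opNorm Δ ≤ (γ - ρ) / C) :
    (∀ k : ℕ, opNorm ((A + Δ) ^ k) ≤ C * γ ^ k) ∧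
      spectralRadius ℂ ((A + Δ).map Complex.ofReal) ≤ ENNReal.ofReal γ := by
  have hγ0 : 0 < γ := hρ.1.trans hγ.1
  have hpow (k : ℕ) : opNorm ((A + Δ) ^ k) ≤ C * γ ^ k := by
    have h := norm_pow_mul_add_pow_le hC hγ.1.le hρ.1.le
      (a := Matrix.toEuclideanCLM (𝕜 := ℝ) A) (d := Matrix.toEuclideanCLM (𝕜 := ℝ) Δ)
      (fun k => by rw [← map_pow]; exact hA k) hΔ k 0
    rw [← map_add, ← map_pow] at h
    simpa [opNorm] using h
  exact ⟨hpow, spectralRadius_map_ofReal_le hγ0 hpow⟩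
end

section
/- Let g be a standard Gaussian vector in ℝ^n, let A₁ be a symmetric positive semidefinite n×n real matrix, and let A₂ be a symmetric n×n real matrix. Then E[(gᵀA₁g)(gᵀA₂g)²] ≥ 2 Tr(A₁)Tr(A₂²) + 4 Tr(A₁A₂²). -/
open MeasureTheory ProbabilityTheory Matrix

/-- The law of a standard Gaussian vector in `ℝ^n`: i.i.d. `N(0,1)` coordinates. -/
noncomputable def stdGaussian (n : ℕ) : Measure (Fin n → ℝ) :=
  Measure.pi fun _ => gaussianReal 0 1

/-- The moments of the standard real Gaussian are finite. -/
lemma integrable_pow_gaussianReal (k : ℕ) :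
    Integrable (fun x : ℝ => x ^ k) (gaussianReal 0 1) := by
  have h := (memLp_id_gaussianReal (μ := 0) (v := 1) k).integrable_norm_pow'
  refine h.mono (by fun_prop) (.of_forall fun x => ?_)
  simp

/-- The recursion satisfied by the moments of the standard real Gaussian. -/
lemma integral_pow_succ_gaussianReal (k : ℕ) :
    ∫ x, x ^ (k + 1) ∂gaussianReal 0 1 = k * ∫ x, x ^ (k - 1) ∂gaussianReal 0 1 := by
  have hint (m : ℕ) : Integrable fun x : ℝ => x ^ m * gaussianPDFReal 0 1 x := by
    have h := integrable_pow_gaussianReal m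
    rw [gaussianReal_of_var_ne_zero _ one_ne_zero,
      integrable_withDensity_iff_integrable_smul' (measurable_gaussianPDF _ _)
        (.of_forall fun _ => gaussianPDF_lt_top)] at h
    simpa [mul_comm] using h
  have hderiv (x : ℝ) : HasDerivAt (fun y => -gaussianPDFReal 0 1 y)
      (x * gaussianPDFReal 0 1 x) x := by
    simp only [gaussianPDFReal_def]
    have h : HasDerivAt (fun y : ℝ => -(y - 0) ^ 2 / (2 * ((1 : NNReal) : ℝ))) (-x) x :=
      ((((hasDerivAt_id x).sub_const 0).pow 2).neg.div_const
        (2 * ((1 : NNReal) : ℝ))).congr_deriv (by simp; ring)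
    exact (h.exp.const_mul (√(2 * Real.pi * ((1 : NNReal) : ℝ)))⁻¹).neg.congr_deriv (by ring)
  have key := integral_mul_deriv_eq_deriv_mul_of_integrable
    (u := fun x : ℝ => x ^ k) (u' := fun x => k * x ^ (k - 1))
    (v := fun x => -gaussianPDFReal 0 1 x) (v' := fun x => x * gaussianPDFReal 0 1 x)
    (fun x _ => hasDerivAt_pow k x) (fun x _ => hderiv x)
    ((hint (k + 1)).congr (.of_forall fun x => by simp [pow_succ, mul_assoc]))
    (((hint (k - 1)).const_mul (-k : ℝ)).congr (.of_forall fun x => by simp [mul_assoc]))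
    ((hint k).neg.congr (.of_forall fun x => by simp))
  rw [integral_gaussianReal_eq_integral_smul one_ne_zero,
    integral_gaussianReal_eq_integral_smul one_ne_zero, ← integral_const_mul]
  calc _ = ∫ x : ℝ, x ^ k * (x * gaussianPDFReal 0 1 x) := by
        congr with x
        simp only [smul_eq_mul]
        ring
    _ = _ := by
        rw [key, ← integral_neg]
        congr with x
        simp only [smul_eq_mul]
        ring

section

open MvPolynomial

variable {n : ℕ}

lemma integrable_eval_stdGaussian (p : MvPolynomial (Fin n) ℝ) :
    Integrable (fun g => eval g p) (stdGaussian n) := by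
  induction p using MvPolynomial.induction_on' with
  | monomial s a =>
    simp only [eval_monomial, Finsupp.prod_fintype _ _ fun _ => pow_zero _]
    exact (Integrable.fintype_prod fun i => integrable_pow_gaussianReal (s i)).const_mul a
  | add p q hp hq => simpa only [map_add] using hp.fun_add hq

/-- The expectation of a polynomial in the coordinates of a standard Gaussian vector. -/
noncomputable def gaussianExpectation (n : ℕ) : MvPolynomial (Fin n) ℝ →ₗ[ℝ] ℝ where
  toFun p := ∫ g, eval g p ∂stdGaussian n
  map_add' p q := by
    simpa using integral_add (integrable_eval_stdGaussian p) (integrable_eval_stdGaussian q)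
  map_smul' c p := by simp [integral_const_mul]

lemma gaussianExpectation_apply (p : MvPolynomial (Fin n) ℝ) :
    gaussianExpectation n p = ∫ g, eval g p ∂stdGaussian n := rfl

lemma gaussianExpectation_monomial (s : Fin n →₀ ℕ) (a : ℝ) :
    gaussianExpectation n (monomial s a) = a * ∏ i, ∫ x, x ^ s i ∂gaussianReal 0 1 := by
  simp only [gaussianExpectation_apply, eval_monomial,
    Finsupp.prod_fintype _ _ fun _ => pow_zero _, integral_const_mul]
  rw [_root_.stdGaussian, integral_fintype_prod_eq_prod (fun i (x : ℝ) => x ^ s i)]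

lemma gaussianExpectation_one : gaussianExpectation n 1 = 1 := by
  have : IsProbabilityMeasure (stdGaussian n) := by unfold _root_.stdGaussian; infer_instance
  simp [gaussianExpectation_apply]

/-- Stein's identity for polynomials. -/
lemma gaussianExpectation_X_mul (i : Fin n) (p : MvPolynomial (Fin n) ℝ) :
    gaussianExpectation n (X i * p) = gaussianExpectation n (pderiv i p) := by
  induction p using MvPolynomial.induction_on' with
  | monomial s a =>
    rw [pderiv_monomial, ← pow_one (X i), ← monomial_single_add, gaussianExpectation_monomial,
      gaussianExpectation_monomial, ← Finset.mul_prod_erase _ _ (Finset.mem_univ i),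
      ← Finset.mul_prod_erase _ _ (Finset.mem_univ i)]
    have h₁ : ∏ j ∈ Finset.univ.erase i,
          ∫ x, x ^ (Finsupp.single i 1 + s : Fin n →₀ ℕ) j ∂gaussianReal 0 1 =
        ∏ j ∈ Finset.univ.erase i, ∫ x, x ^ s j ∂gaussianReal 0 1 :=
      Finset.prod_congr rfl fun j hj => by
        simp [Finsupp.single_eq_of_ne (Finset.ne_of_mem_erase hj)]
    have h₂ : ∏ j ∈ Finset.univ.erase i,
          ∫ x, x ^ (s - Finsupp.single i 1 : Fin n →₀ ℕ) j ∂gaussianReal 0 1 =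
        ∏ j ∈ Finset.univ.erase i, ∫ x, x ^ s j ∂gaussianReal 0 1 :=
      Finset.prod_congr rfl fun j hj => by
        simp [Finsupp.single_eq_of_ne (Finset.ne_of_mem_erase hj)]
    rw [h₁, h₂]
    simp only [Finsupp.add_apply, Finsupp.tsub_apply, Finsupp.single_eq_same, add_comm 1]
    rw [integral_pow_succ_gaussianReal]
    ring
  | add p q hp hq => simp only [mul_add, map_add, hp, hq]

/-- The linear form `x ↦ (A x) i`. -/
noncomputable def rowForm (A : Matrix (Fin n) (Fin n) ℝ) (i : Fin n) :
    MvPolynomial (Fin n) ℝ :=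
  ∑ j, C (A i j) * X j

/-- The quadratic form `x ↦ xᵀ A x`. -/
noncomputable def quadForm (A : Matrix (Fin n) (Fin n) ℝ) : MvPolynomial (Fin n) ℝ :=
  ∑ i, X i * rowForm A i

lemma eval_quadForm (A : Matrix (Fin n) (Fin n) ℝ) (g : Fin n → ℝ) :
    eval g (quadForm A) = g ⬝ᵥ A.mulVec g := by
  simp [quadForm, rowForm, dotProduct, mulVec]

lemma pderiv_rowForm (A : Matrix (Fin n) (Fin n) ℝ) (i j : Fin n) :
    pderiv i (rowForm A j) = C (A j i) := by
  simp [rowForm, pderiv_X, Pi.single_apply]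

lemma pderiv_quadForm {A : Matrix (Fin n) (Fin n) ℝ} (hA : A.IsSymm) (i : Fin n) :
    pderiv i (quadForm A) = 2 * rowForm A i := by
  have h : ∑ j, X j * C (A j i) = rowForm A i :=
    Finset.sum_congr rfl fun j _ => by rw [hA.apply, mul_comm]
  simp only [quadForm, map_sum, pderiv_mul, pderiv_rowForm, Finset.sum_add_distrib, h, two_mul]
  simp [pderiv_X, Pi.single_apply]

lemma sum_rowForm_mul_rowForm (A B : Matrix (Fin n) (Fin n) ℝ) :
    ∑ i, rowForm A i * rowForm B i = quadForm (Aᵀ * B) := by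
  simp only [quadForm, rowForm, Matrix.mul_apply, Matrix.transpose_apply, map_sum, map_mul,
    Finset.sum_mul, Finset.mul_sum]
  rw [Finset.sum_comm_cycle]
  refine Finset.sum_congr rfl fun j _ => ?_
  rw [Finset.sum_comm]
  exact Finset.sum_congr rfl fun k _ =>
    Finset.sum_congr rfl fun i _ => by ring

lemma gaussianExpectation_quadForm_mul (A : Matrix (Fin n) (Fin n) ℝ)
    (p : MvPolynomial (Fin n) ℝ) :
    gaussianExpectation n (quadForm A * p) = A.trace * gaussianExpectation n p +
      gaussianExpectation n (∑ i, rowForm A i * pderiv i p) := by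
  simp only [quadForm, Finset.sum_mul, mul_assoc, map_sum, gaussianExpectation_X_mul,
    pderiv_mul, pderiv_rowForm, map_add, Finset.sum_add_distrib, C_mul', map_smul, smul_eq_mul,
    Matrix.trace, Matrix.diag]

lemma gaussianExpectation_quadForm (A : Matrix (Fin n) (Fin n) ℝ) :
    gaussianExpectation n (quadForm A) = A.trace := by
  simpa [gaussianExpectation_one] using gaussianExpectation_quadForm_mul A 1

lemma gaussianExpectation_quadForm_mul_quadForm (A : Matrix (Fin n) (Fin n) ℝ)
    {B : Matrix (Fin n) (Fin n) ℝ} (hB : B.IsSymm) :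
    gaussianExpectation n (quadForm A * quadForm B) =
      A.trace * B.trace + 2 * (Aᵀ * B).trace := by
  have h : ∑ i, rowForm A i * pderiv i (quadForm B) = (2 : ℝ) • quadForm (Aᵀ * B) := by
    rw [← sum_rowForm_mul_rowForm, Finset.smul_sum]
    refine Finset.sum_congr rfl fun i _ => ?_
    rw [pderiv_quadForm hB, smul_eq_C_mul, map_ofNat]
    ring
  rw [gaussianExpectation_quadForm_mul, h, map_smul, gaussianExpectation_quadForm,
    gaussianExpectation_quadForm, smul_eq_mul]

lemma gaussianExpectation_quadForm_mul_quadForm_sq (A : Matrix (Fin n) (Fin n) ℝ)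
    {B : Matrix (Fin n) (Fin n) ℝ} (hB : B.IsSymm) :
    gaussianExpectation n (quadForm A * quadForm B ^ 2) =
      A.trace * (B.trace ^ 2 + 2 * (B * B).trace) +
        4 * ((Aᵀ * B).trace * B.trace + 2 * (A * (B * B)).trace) := by
  have h : ∑ i, rowForm A i * pderiv i (quadForm B ^ 2) =
      (4 : ℝ) • (quadForm (Aᵀ * B) * quadForm B) := by
    rw [← sum_rowForm_mul_rowForm, Finset.sum_mul, Finset.smul_sum]
    refine Finset.sum_congr rfl fun i _ => ?_
    rw [sq, pderiv_mul, pderiv_quadForm hB, smul_eq_C_mul, map_ofNat]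
    ring
  have htr : ((Aᵀ * B)ᵀ * B).trace = (A * (B * B)).trace := by
    rw [Matrix.transpose_mul, Matrix.transpose_transpose, hB.eq, Matrix.mul_assoc,
      Matrix.trace_mul_comm, Matrix.mul_assoc]
  rw [gaussianExpectation_quadForm_mul, h, map_smul,
    gaussianExpectation_quadForm_mul_quadForm _ hB, sq,
    gaussianExpectation_quadForm_mul_quadForm _ hB, hB.eq, htr, smul_eq_mul]
  ring

end

/-- **Lower bound on a Gaussian sixth-moment expression.**
For a standard Gaussian `g` in `ℝ^n`, `A₁` symmetric positive semidefinite and `A₂` symmetric,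
`E[(gᵀA₁g)(gᵀA₂g)²] ≥ 2 Tr A₁ Tr (A₂²) + 4 Tr (A₁A₂²)`. -/
theorem gaussian_sixth_moment_lower_bound {n : ℕ} (A₁ A₂ : Matrix (Fin n) (Fin n) ℝ)
    (h₁ : A₁.PosSemidef) (h₂ : A₂.IsSymm) :
    2 * A₁.trace * (A₂ * A₂).trace + 4 * (A₁ * (A₂ * A₂)).trace ≤
      ∫ g : Fin n → ℝ,
        (g ⬝ᵥ A₁.mulVec g) * (g ⬝ᵥ A₂.mulVec g) ^ 2 ∂(stdGaussian n) := by
  have hA₁ : A₁ᵀ = A₁ := by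
    rw [← Matrix.conjTranspose_eq_transpose_of_trivial, h₁.isHermitian.eq]
  have hE := gaussianExpectation_quadForm_mul_quadForm_sq A₁ h₂
  simp only [gaussianExpectation_apply, map_mul, map_pow, eval_quadForm, hA₁] at hE
  rw [hE]
  set t := A₂.trace with ht
  set M : Matrix (Fin n) (Fin n) ℝ := t • 1 + (2 : ℝ) • A₂ with hM
  have hMsymm : Mᴴ = M := by
    simp [hM, Matrix.conjTranspose_eq_transpose_of_trivial, h₂.eq]
  have hpos := (h₁.conjTranspose_mul_mul_same M).trace_nonneg
  have hexp : (Mᴴ * A₁ * M).trace =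
      t ^ 2 * A₁.trace + 4 * t * (A₁ * A₂).trace + 4 * (A₁ * (A₂ * A₂)).trace := by
    rw [hMsymm, Matrix.mul_assoc, Matrix.trace_mul_comm, Matrix.mul_assoc, hM]
    simp only [Matrix.mul_add, Matrix.add_mul, Matrix.smul_mul, Matrix.mul_smul, Matrix.one_mul,
      Matrix.mul_one, Matrix.trace_add, Matrix.trace_smul, smul_eq_mul]
    ring
  rw [hexp] at hpos
  linarith
end

section
/- With L(K) := A + BK = B(K − K⋆) and J_Σ(K) := Σ_{t=1}^{T} Σ_{ℓ=0}^{t−1} Tr(L(K)^ℓ Σ (L(K)^ℓ)ᵀ), the function J_Σ satisfies the quadratic growth condition: for every K ∈ ℝ^{d×n}, J_Σ(K) − J_Σ(K⋆) ≥ (T−1) λ_min(Σ) σ_min(B)² ‖K − K⋆‖_F². -/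
open Matrix Finset

/-- The finite-horizon LQR cost `J_Σ(K) = Σ_{t=1}^{T} Σ_{ℓ=0}^{t−1} Tr(L(K)^ℓ Σ (L(K)^ℓ)ᵀ)`
with closed-loop matrix `L(K) = A + BK`. -/
noncomputable def Jcost {n d : ℕ} (A : Matrix (Fin n) (Fin n) ℝ)
    (B : Matrix (Fin n) (Fin d) ℝ) (Sig : Matrix (Fin n) (Fin n) ℝ) (T : ℕ)
    (K : Matrix (Fin d) (Fin n) ℝ) : ℝ :=
  ∑ t ∈ Finset.Icc 1 T, ∑ ℓ ∈ Finset.range t,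
    ((A + B * K) ^ ℓ * Sig * ((A + B * K) ^ ℓ)ᵀ).trace

open Classical in
/-- The minimum eigenvalue of a (Hermitian) real matrix. -/
noncomputable def matMinEig {n : ℕ} (M : Matrix (Fin n) (Fin n) ℝ) : ℝ :=
  if h : M.IsHermitian then ⨅ i, h.eigenvalues i else 0

/-- A Hermitian matrix dominates its smallest eigenvalue times the identity. -/
theorem posSemidef_sub_matMinEig_smul_one {n : ℕ} {M : Matrix (Fin n) (Fin n) ℝ}
    (hM : M.IsHermitian) : (M - matMinEig M • (1 : Matrix (Fin n) (Fin n) ℝ)).PosSemidef := by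
  classical
  have hle (i : Fin n) : matMinEig M ≤ hM.eigenvalues i := by
    rw [matMinEig, dif_pos hM]
    convert ciInf_le (Set.finite_range hM.eigenvalues).bddBelow i
  have hD : (diagonal fun i => hM.eigenvalues i - matMinEig M).PosSemidef :=
    PosSemidef.diagonal fun i => sub_nonneg.2 (hle i)
  have hspec := hM.spectral_theorem
  rw [Unitary.conjStarAlgAut_apply] at hspec
  have hU : (hM.eigenvectorUnitary : Matrix (Fin n) (Fin n) ℝ) *
      star (hM.eigenvectorUnitary : Matrix (Fin n) (Fin n) ℝ) = 1 :=
    Unitary.mul_star_self_of_mem hM.eigenvectorUnitary.2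
  convert hD.mul_mul_conjTranspose_same
    (hM.eigenvectorUnitary : Matrix (Fin n) (Fin n) ℝ) using 1
  have hdiag : (diagonal fun i => hM.eigenvalues i - matMinEig M) =
      diagonal (RCLike.ofReal ∘ hM.eigenvalues) -
        matMinEig M • (1 : Matrix (Fin n) (Fin n) ℝ) := by
    rw [smul_one_eq_diagonal, diagonal_sub]
    rfl
  rw [hdiag, mul_sub, sub_mul, ← star_eq_conjTranspose, ← hspec, mul_smul_comm, mul_one,
    smul_mul_assoc, hU]

theorem matMinEig_mul_trace_le {m n : ℕ} {M : Matrix (Fin n) (Fin n) ℝ}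
    (hM : M.IsHermitian) (X : Matrix (Fin m) (Fin n) ℝ) :
    matMinEig M * (X * Xᵀ).trace ≤ (X * M * Xᵀ).trace := by
  have h := ((posSemidef_sub_matMinEig_smul_one hM).mul_mul_conjTranspose_same X).trace_nonneg
  rw [conjTranspose_eq_transpose_of_trivial, Matrix.mul_sub, Matrix.sub_mul, trace_sub,
    Matrix.mul_smul, Matrix.mul_one, Matrix.smul_mul, trace_smul, smul_eq_mul] at h
  linarith

theorem matMinEig_nonneg {n : ℕ} {M : Matrix (Fin n) (Fin n) ℝ} (hM : M.PosSemidef) :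
    0 ≤ matMinEig M := by
  rw [matMinEig, dif_pos hM.isHermitian]
  exact Real.iInf_nonneg fun i => by convert hM.eigenvalues_nonneg i

/-- With a vanishing closed loop only the terms `ℓ = 0` contribute to the cost. -/
theorem Jcost_of_closedLoop_eq_zero {n d : ℕ} {A : Matrix (Fin n) (Fin n) ℝ}
    {B : Matrix (Fin n) (Fin d) ℝ} (Sig : Matrix (Fin n) (Fin n) ℝ) (T : ℕ)
    {K : Matrix (Fin d) (Fin n) ℝ} (hK : A + B * K = 0) :
    Jcost A B Sig T K = T * Sig.trace := by
  have hinner (t : ℕ) (ht : t ∈ Icc 1 T) :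
      ∑ ℓ ∈ range t, ((A + B * K) ^ ℓ * Sig * ((A + B * K) ^ ℓ)ᵀ).trace = Sig.trace := by
    rw [sum_eq_single_of_mem 0 (mem_range.2 (mem_Icc.1 ht).1)]
    · simp
    · intro ℓ _ hℓ
      simp [hK, zero_pow hℓ]
  rw [Jcost, sum_congr rfl hinner]
  simp

/-- The terms `ℓ = 0` and `ℓ = 1` bound the cost from below. -/
theorem le_Jcost {n d : ℕ} (A : Matrix (Fin n) (Fin n) ℝ)
    (B : Matrix (Fin n) (Fin d) ℝ) {Sig : Matrix (Fin n) (Fin n) ℝ} (hSig : Sig.PosSemidef)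
    {T : ℕ} (hT : 1 ≤ T) (K : Matrix (Fin d) (Fin n) ℝ) :
    T * Sig.trace + ((T : ℝ) - 1) * ((A + B * K) * Sig * (A + B * K)ᵀ).trace ≤
      Jcost A B Sig T K := by
  have hnonneg (ℓ : ℕ) : 0 ≤ ((A + B * K) ^ ℓ * Sig * ((A + B * K) ^ ℓ)ᵀ).trace := by
    have h := (hSig.mul_mul_conjTranspose_same ((A + B * K) ^ ℓ)).trace_nonneg
    rwa [conjTranspose_eq_transpose_of_trivial] at h
  induction T, hT using Nat.le_induction with
  | base => simp [Jcost]
  | succ T hT ih =>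
    have hstep : Jcost A B Sig (T + 1) K = Jcost A B Sig T K +
        ∑ ℓ ∈ range (T + 1), ((A + B * K) ^ ℓ * Sig * ((A + B * K) ^ ℓ)ᵀ).trace :=
      sum_Icc_succ_top (by omega) _
    have hlast := sum_le_sum_of_subset_of_nonneg
      (range_mono (show 2 ≤ T + 1 by omega)) fun ℓ _ _ => hnonneg ℓ
    simp only [sum_range_succ _ 1, sum_range_one, pow_zero, pow_one, one_mul, transpose_one,
      mul_one] at hlast
    rw [hstep]
    push_cast
    linarith

/-- **Quadratic growth of the LQR cost.**  With `L(K) = A + BK = B(K − K⋆)`,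
`J_Σ(K) − J_Σ(K⋆) ≥ (T−1) λ_min(Σ) σ_min(B)² ‖K − K⋆‖_F²`,
where `σ_min(B)² = λ_min(BᵀB)` and `‖M‖_F² = Tr(MᵀM)`. -/
theorem Jcost_quadratic_growth {n d : ℕ} (A : Matrix (Fin n) (Fin n) ℝ)
    (B : Matrix (Fin n) (Fin d) ℝ) (Kstar : Matrix (Fin d) (Fin n) ℝ)
    (Sig : Matrix (Fin n) (Fin n) ℝ) (T : ℕ)
    (hdn : d ≤ n) (hB : B.rank = d) (hK : A + B * Kstar = 0)
    (hSig : Sig.PosDef) (hT : 2 ≤ T) (K : Matrix (Fin d) (Fin n) ℝ) :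
    ((T : ℝ) - 1) * matMinEig Sig * matMinEig (Bᵀ * B) *
        ((K - Kstar)ᵀ * (K - Kstar)).trace ≤
      Jcost A B Sig T K - Jcost A B Sig T Kstar := by
  have hL : A + B * K = B * (K - Kstar) := by
    rw [Matrix.mul_sub, eq_sub_iff_add_eq, add_right_comm, hK, zero_add]
  have hBB : (Bᵀ * B).IsHermitian := by
    rw [IsHermitian, conjTranspose_eq_transpose_of_trivial, transpose_mul, transpose_transpose]
  have hcontract := matMinEig_mul_trace_le hBB (K - Kstar)ᵀ
  have hassoc : (K - Kstar)ᵀ * (Bᵀ * B) * (K - Kstar) =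
      (A + B * K)ᵀ * (A + B * K) := by
    rw [hL, transpose_mul]
    simp only [Matrix.mul_assoc]
  rw [transpose_transpose, hassoc, trace_mul_comm (A + B * K)ᵀ] at hcontract
  have hquad : matMinEig Sig * (matMinEig (Bᵀ * B) * ((K - Kstar)ᵀ * (K - Kstar)).trace) ≤
      ((A + B * K) * Sig * (A + B * K)ᵀ).trace :=
    (mul_le_mul_of_nonneg_left hcontract (matMinEig_nonneg hSig.posSemidef)).trans
      (matMinEig_mul_trace_le hSig.isHermitian _)
  have hT1 : (0 : ℝ) ≤ (T : ℝ) - 1 := by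
    rw [sub_nonneg]
    exact_mod_cast (by omega : 1 ≤ T)
  have hcost := le_Jcost A B hSig.posSemidef (show 1 ≤ T by omega) K
  rw [Jcost_of_closedLoop_eq_zero Sig T hK, mul_assoc, mul_assoc]
  linarith [mul_le_mul_of_nonneg_left hquad hT1]
end

section
/- With L(K) := A + BK and J_Σ(K) := Σ_{t=1}^{T} Σ_{ℓ=0}^{t−1} Tr(L(K)^ℓ Σ (L(K)^ℓ)ᵀ), the map K ↦ J_Σ(K) is differentiable on ℝ^{d×n} and its Fréchet derivative at K in direction Δ ∈ ℝ^{d×n} equals ⟨G(K), Δ⟩_F, where G(K) := 2(T−1) Bᵀ L(K) Σ + 2 Σ_{ℓ=2}^{T−1} Σ_{k=0}^{ℓ−1} (T−ℓ) Bᵀ (L(K)^k)ᵀ L(K)^ℓ Σ (L(K)^{ℓ−k−1})ᵀ; i.e., G(K) is the gradient of J_Σ at K. -/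
open Matrix Finset

attribute [local instance] Matrix.normedAddCommGroup Matrix.normedSpace

/-- The candidate gradient of `J_Σ` at `K`:
`G(K) = 2(T−1) Bᵀ L(K) Σ
  + 2 Σ_{ℓ=2}^{T−1} Σ_{k=0}^{ℓ−1} (T−ℓ) Bᵀ (L(K)^k)ᵀ L(K)^ℓ Σ (L(K)^{ℓ−k−1})ᵀ`. -/
noncomputable def Gmat {n d : ℕ} (A : Matrix (Fin n) (Fin n) ℝ)
    (B : Matrix (Fin n) (Fin d) ℝ) (Sig : Matrix (Fin n) (Fin n) ℝ) (T : ℕ)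
    (K : Matrix (Fin d) (Fin n) ℝ) : Matrix (Fin d) (Fin n) ℝ :=
  (2 * ((T : ℝ) - 1)) • (Bᵀ * (A + B * K) * Sig) +
    (2 : ℝ) • ∑ ℓ ∈ Finset.Icc 2 (T - 1), ∑ k ∈ Finset.range ℓ,
      ((T : ℝ) - ℓ) •
        (Bᵀ * ((A + B * K) ^ k)ᵀ * (A + B * K) ^ ℓ * Sig * ((A + B * K) ^ (ℓ - k - 1))ᵀ)

/-- Product rule for rectangular matrix-valued maps. -/
theorem hasFDerivAt_matrix_mul {E : Type*} [NormedAddCommGroup E] [NormedSpace ℝ E]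
    {l m n : Type*} [Fintype l] [Fintype m] [Fintype n]
    {f : E → Matrix l m ℝ} {g : E → Matrix m n ℝ}
    {f' : E →L[ℝ] Matrix l m ℝ} {g' : E →L[ℝ] Matrix m n ℝ} {x : E}
    (hf : HasFDerivAt f f' x) (hg : HasFDerivAt g g' x) :
    ∃ D : E →L[ℝ] Matrix l n ℝ, (∀ v, D v = f x * g' v + f' v * g x) ∧
      HasFDerivAt (fun y => f y * g y) D x := by
  let b : Matrix l m ℝ →L[ℝ] Matrix m n ℝ →L[ℝ] Matrix l n ℝ :=
    LinearMap.toContinuousLinearMap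
      ((LinearMap.toContinuousLinearMap (𝕜 := ℝ) (E := Matrix m n ℝ)
        (F' := Matrix l n ℝ)).toLinearMap ∘ₗ mulLinearMap ℝ)
  exact ⟨_, fun v => rfl, b.hasFDerivAt_of_bilinear hf hg⟩

/-- The derivative of a power of a square-matrix-valued map. -/
theorem hasFDerivAt_matrix_pow {E : Type*} [NormedAddCommGroup E] [NormedSpace ℝ E]
    {n : Type*} [Fintype n] [DecidableEq n] {f : E → Matrix n n ℝ}
    {f' : E →L[ℝ] Matrix n n ℝ} {x : E} (hf : HasFDerivAt f f' x) (ℓ : ℕ) :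
    ∃ D : E →L[ℝ] Matrix n n ℝ,
      (∀ v, D v = ∑ k ∈ range ℓ, f x ^ k * f' v * f x ^ (ℓ - k - 1)) ∧
      HasFDerivAt (fun y => f y ^ ℓ) D x := by
  induction ℓ with
  | zero => exact ⟨0, by simp, by simpa using hasFDerivAt_const (1 : Matrix n n ℝ) x⟩
  | succ ℓ ih =>
    obtain ⟨D, hD, h⟩ := ih
    obtain ⟨D', hD', h'⟩ := hasFDerivAt_matrix_mul h hf
    refine ⟨D', fun v => ?_, by simpa only [pow_succ] using h'⟩
    rw [hD', hD, sum_range_succ, sum_mul, add_comm]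
    congr 1
    · refine sum_congr rfl fun k hk => ?_
      have hk' := mem_range.1 hk
      rw [show ℓ + 1 - k - 1 = ℓ - k - 1 + 1 by omega, pow_succ, ← mul_assoc]
    · simp

/-- The derivative of the quadratic form `M ↦ Tr(M S Mᵀ)` with symmetric `S` along a
matrix-valued map. -/
theorem hasFDerivAt_trace_mul_mul_transpose {E : Type*} [NormedAddCommGroup E]
    [NormedSpace ℝ E] {m n : Type*} [Fintype m] [Fintype n] {S : Matrix n n ℝ} (hS : Sᵀ = S)
    {f : E → Matrix m n ℝ} {f' : E →L[ℝ] Matrix m n ℝ} {x : E} (hf : HasFDerivAt f f' x) :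
    ∃ D : E →L[ℝ] ℝ, (∀ v, D v = 2 * (f x * S * (f' v)ᵀ).trace) ∧
      HasFDerivAt (fun y => (f y * S * (f y)ᵀ).trace) D x := by
  obtain ⟨D₁, hD₁, h₁⟩ := hasFDerivAt_matrix_mul hf (hasFDerivAt_const S x)
  let τ : Matrix m n ℝ →L[ℝ] Matrix n m ℝ :=
    LinearMap.toContinuousLinearMap (transposeLinearEquiv m n ℝ ℝ).toLinearMap
  obtain ⟨D', hD', h'⟩ : ∃ D' : E →L[ℝ] Matrix n m ℝ, (∀ v, D' v = (f' v)ᵀ) ∧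
      HasFDerivAt (fun y => (f y)ᵀ) D' x :=
    ⟨_, fun _ => rfl, τ.hasFDerivAt.comp x hf⟩
  obtain ⟨D₂, hD₂, h₂⟩ := hasFDerivAt_matrix_mul h₁ h'
  let tr : Matrix m m ℝ →L[ℝ] ℝ := LinearMap.toContinuousLinearMap (traceLinearMap m ℝ ℝ)
  refine ⟨tr.comp D₂, fun v => ?_, tr.hasFDerivAt.comp x h₂⟩
  change (D₂ v).trace = _
  have hsymm : (f' v * S * (f x)ᵀ).trace = (f x * S * (f' v)ᵀ).trace := by
    rw [← trace_transpose]
    simp [transpose_mul, hS, Matrix.mul_assoc]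
  rw [hD₂, hD₁, hD', trace_add]
  simp [hsymm, two_mul]

theorem sum_Icc_sum_range_eq (T : ℕ) (a : ℕ → ℝ) :
    ∑ t ∈ Icc 1 T, ∑ ℓ ∈ range t, a ℓ = ∑ ℓ ∈ range T, ((T : ℝ) - ℓ) * a ℓ := by
  induction T with
  | zero => simp
  | succ T ih =>
    rw [sum_Icc_succ_top (by omega), ih, sum_range_succ, sum_range_succ, ← add_assoc,
      ← sum_add_distrib]
    push_cast
    congr 1
    · exact sum_congr rfl fun _ _ => by ring
    · ring

theorem hasFDerivAt_weighted_sum {E ι : Type*} [NormedAddCommGroup E] [NormedSpace ℝ E]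
    {f : ι → E → ℝ} {f' : ι → E →L[ℝ] ℝ} {x : E} (s : Finset ι) (c : ι → ℝ)
    (hf : ∀ i, HasFDerivAt (f i) (f' i) x) :
    ∃ D : E →L[ℝ] ℝ, (∀ v, D v = ∑ i ∈ s, c i * f' i v) ∧
      HasFDerivAt (fun y => ∑ i ∈ s, c i * f i y) D x :=
  ⟨∑ i ∈ s, c i • f' i, fun v => by simp,
    HasFDerivAt.fun_sum fun i _ => (hf i).const_mul (c i)⟩

theorem trace_gradient_term {m n : Type*} [Fintype m] [Fintype n]
    (B : Matrix n m ℝ) (P Q R : Matrix n n ℝ) (Δ : Matrix m n ℝ) :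
    (Q * (P * (B * Δ) * R)ᵀ).trace = (Bᵀ * Pᵀ * Q * Rᵀ * Δᵀ).trace := by
  simp only [transpose_mul, Matrix.mul_assoc]
  rw [← Matrix.mul_assoc Q, ← Matrix.mul_assoc (Q * Rᵀ), trace_mul_comm]
  simp only [Matrix.mul_assoc]

theorem trace_Gmat_mul_transpose {n d : ℕ} (A : Matrix (Fin n) (Fin n) ℝ)
    (B : Matrix (Fin n) (Fin d) ℝ) (Sig : Matrix (Fin n) (Fin n) ℝ) {T : ℕ} (hT : 2 ≤ T)
    (K Δ : Matrix (Fin d) (Fin n) ℝ) :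
    (Gmat A B Sig T K * Δᵀ).trace = ∑ ℓ ∈ range T, ((T : ℝ) - ℓ) *
      (2 * ((A + B * K) ^ ℓ * Sig * (∑ k ∈ range ℓ,
        (A + B * K) ^ k * (B * Δ) * (A + B * K) ^ (ℓ - k - 1))ᵀ).trace) := by
  have hrange : range T = insert 0 (insert 1 (Icc 2 (T - 1))) := by
    ext; simp; omega
  rw [hrange, sum_insert (by simp), sum_insert (by simp), Gmat]
  simp only [transpose_sum, Matrix.mul_sum, trace_sum, trace_gradient_term]
  simp [Matrix.add_mul, Matrix.sum_mul, trace_sum, mul_sum, Matrix.mul_assoc]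
  congr 1
  · ring
  · exact sum_congr rfl fun _ _ => sum_congr rfl fun _ _ => by ring

/-- **`G(K)` is the gradient of the LQR cost `J_Σ`.**  The map `K ↦ J_Σ(K)` is
differentiable and its Fréchet derivative at `K` acts on a direction `Δ` as
`⟨G(K), Δ⟩_F = Tr(G(K) Δᵀ)`. -/
theorem Jcost_hasFDerivAt {n d : ℕ} (A : Matrix (Fin n) (Fin n) ℝ)
    (B : Matrix (Fin n) (Fin d) ℝ) (Sig : Matrix (Fin n) (Fin n) ℝ) (T : ℕ)
    (hSig : Sig.PosDef) (hT : 2 ≤ T) (K : Matrix (Fin d) (Fin n) ℝ) :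
    ∃ L' : Matrix (Fin d) (Fin n) ℝ →L[ℝ] ℝ,
      (∀ Δ : Matrix (Fin d) (Fin n) ℝ, L' Δ = (Gmat A B Sig T K * Δᵀ).trace) ∧
      HasFDerivAt (fun K' => Jcost A B Sig T K') L' K := by
  have hS : Sigᵀ = Sig := by simpa using hSig.isHermitian.eq
  let F : Matrix (Fin d) (Fin n) ℝ →L[ℝ] Matrix (Fin n) (Fin n) ℝ :=
    LinearMap.toContinuousLinearMap (mulLeftLinearMap (Fin n) ℝ B)
  have hF : HasFDerivAt (fun K' => A + B * K') F K := F.hasFDerivAt.const_add A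
  choose P hP hPd using hasFDerivAt_matrix_pow hF
  choose Q hQ hQd using fun ℓ => hasFDerivAt_trace_mul_mul_transpose hS (hPd ℓ)
  obtain ⟨D, hD, hDd⟩ := hasFDerivAt_weighted_sum (range T) (fun ℓ => (T : ℝ) - ℓ) hQd
  refine ⟨D, fun Δ => ?_, ?_⟩
  · rw [trace_Gmat_mul_transpose A B Sig hT]
    refine (hD Δ).trans ?_
    simp only [hQ, hP]
    rfl
  · simp only [Jcost, sum_Icc_sum_range_eq]
    exact hDd
end

section
/- With L(K) := A + BK = B(K − K⋆) and J_Σ(K) := Σ_{t=1}^{T} Σ_{ℓ=0}^{t−1} Tr(L(K)^ℓ Σ (L(K)^ℓ)ᵀ), for every direction H ∈ ℝ^{d×n} the real function f(s) := J_Σ(K⋆ + sH) is twice differentiable at 0 with f''(0) = 2(T−1) Tr(Σ Hᵀ Bᵀ B H); i.e., the Hessian of J_Σ at the minimizer K⋆ acts on (H,H) as 2(T−1) Tr(Σ Hᵀ BᵀB H). -/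
open Matrix Finset

/-- The cost along a line through a gain `K` cancelling the closed loop is a polynomial in the
line parameter. -/
lemma Jcost_add_smul_eq_eval {n d : ℕ} {A : Matrix (Fin n) (Fin n) ℝ}
    {B : Matrix (Fin n) (Fin d) ℝ} {K : Matrix (Fin d) (Fin n) ℝ}
    (Sig : Matrix (Fin n) (Fin n) ℝ) (T : ℕ) (hK : A + B * K = 0)
    (H : Matrix (Fin d) (Fin n) ℝ) (s : ℝ) :
    Jcost A B Sig T (K + s • H) =
      (∑ t ∈ Finset.Icc 1 T, ∑ l ∈ Finset.range t,
        Polynomial.monomial (2 * l) ((B * H) ^ l * Sig * ((B * H) ^ l)ᵀ).trace).eval s := by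
  have hL : A + B * (K + s • H) = s • (B * H) := by
    rw [Matrix.mul_add, ← add_assoc, hK, zero_add, Matrix.mul_smul]
  simp only [Jcost, hL, Polynomial.eval_finsetSum, Polynomial.eval_monomial]
  refine Finset.sum_congr rfl fun t _ => Finset.sum_congr rfl fun l _ => ?_
  rw [smul_pow, Matrix.transpose_smul, Matrix.smul_mul, Matrix.smul_mul, Matrix.mul_smul,
    Matrix.trace_smul, Matrix.trace_smul, smul_eq_mul, smul_eq_mul]
  ring

/-- The quadratic coefficient of a doubly summed even polynomial. -/
lemma coeff_two_sum_sum_monomial (c : ℕ → ℝ) {T : ℕ} (hT : 1 ≤ T) :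
    (∑ t ∈ Finset.Icc 1 T, ∑ l ∈ Finset.range t,
      Polynomial.monomial (2 * l) (c l)).coeff 2 = ((T : ℝ) - 1) * c 1 := by
  have hl (l : ℕ) : (2 * l = 2) ↔ (l = 1) := by omega
  simp only [Polynomial.finsetSum_coeff, Polynomial.coeff_monomial, hl, Finset.sum_ite_eq',
    Finset.mem_range]
  induction T, hT using Nat.le_induction with
  | base => simp
  | succ m hm ih =>
    rw [Finset.sum_Icc_succ_top (by omega), ih, if_pos (by omega)]
    push_cast
    ring

/-- The second derivative of a polynomial function at zero. -/
lemma hasDerivAt_deriv_eval_zero (p : Polynomial ℝ) :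
    HasDerivAt (deriv fun s : ℝ => p.eval s) (2 * p.coeff 2) 0 := by
  have h : (deriv fun s : ℝ => p.eval s) = fun s => p.derivative.eval s := by
    funext s
    exact p.deriv
  have hc : p.derivative.derivative.eval 0 = 2 * p.coeff 2 := by
    rw [← Polynomial.coeff_zero_eq_eval_zero, Polynomial.coeff_derivative,
      Polynomial.coeff_derivative]
    norm_num
    ring
  rw [h, ← hc]
  exact p.derivative.hasDerivAt 0

/-- **Hessian of the LQR cost at the optimum.**  With `L(K) = A + BK = B(K − K⋆)`,
for every direction `H` the function `f(s) = J_Σ(K⋆ + sH)` is (twice) differentiable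
with `f''(0) = 2 (T−1) Tr(Σ Hᵀ Bᵀ B H)`. -/
theorem Jcost_hessian_at_opt {n d : ℕ} (A : Matrix (Fin n) (Fin n) ℝ)
    (B : Matrix (Fin n) (Fin d) ℝ) (Kstar : Matrix (Fin d) (Fin n) ℝ)
    (Sig : Matrix (Fin n) (Fin n) ℝ) (T : ℕ)
    (hdn : d ≤ n) (hB : B.rank = d) (hK : A + B * Kstar = 0)
    (hSig : Sig.PosDef) (hT : 2 ≤ T) (H : Matrix (Fin d) (Fin n) ℝ) :
    (∀ s : ℝ, DifferentiableAt ℝ (fun s : ℝ => Jcost A B Sig T (Kstar + s • H)) s) ∧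
    HasDerivAt (deriv (fun s : ℝ => Jcost A B Sig T (Kstar + s • H)))
      (2 * ((T : ℝ) - 1) * (Sig * Hᵀ * Bᵀ * B * H).trace) 0 := by
  simp only [Jcost_add_smul_eq_eval Sig T hK H]
  refine ⟨fun s => Polynomial.differentiableAt _, ?_⟩
  have htr : (Sig * Hᵀ * Bᵀ * B * H).trace =
      ((B * H) ^ 1 * Sig * ((B * H) ^ 1)ᵀ).trace := by
    rw [pow_one, Matrix.mul_assoc (B * H), Matrix.trace_mul_comm (B * H), Matrix.transpose_mul]
    simp only [Matrix.mul_assoc]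
  rw [htr, mul_assoc, ← coeff_two_sum_sum_monomial
    (fun l => ((B * H) ^ l * Sig * ((B * H) ^ l)ᵀ).trace) (by omega)]
  exact hasDerivAt_deriv_eval_zero _
end

section
/- Let A ∈ ℝ^{n×n} with operator norm ‖A‖ < 1, B ∈ ℝ^{n×d}, and Q ∈ ℝ^{n×n} symmetric. Suppose P is a symmetric positive semidefinite n×n matrix with BᵀPB invertible satisfying the discrete algebraic Riccati equation P = AᵀPA − AᵀPB(BᵀPB)⁻¹BᵀPA + Q. Then P ⪯ AᵀPA + Q, and consequently ‖P‖ ≤ ‖Q‖ / (1 − ‖A‖²). -/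
open Matrix

/-- The spectral norm is monotone on positive semidefinite matrices. -/
lemma opNorm_le_opNorm_of_posSemidef_sub {n : ℕ} {P R : Matrix (Fin n) (Fin n) ℝ}
    (hP : P.PosSemidef) (hPR : (R - P).PosSemidef) : opNorm P ≤ opNorm R := by
  have hquad (M : Matrix (Fin n) (Fin n) ℝ) (x : EuclideanSpace ℝ (Fin n)) :
      (toEuclideanCLM (𝕜 := ℝ) M).reApplyInnerSelf x = x.ofLp ⬝ᵥ M *ᵥ x.ofLp := by
    rw [ContinuousLinearMap.reApplyInnerSelf_apply, real_inner_comm, inner_toEuclideanCLM]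
    rfl
  have hsymm : (toEuclideanCLM (𝕜 := ℝ) P).IsSymmetric := by
    rw [coe_toEuclideanCLM_eq_toEuclideanLin]
    exact isSymmetric_toEuclideanLin_iff.mpr hP.1
  rw [opNorm, ContinuousLinearMap.norm_eq_iSup_rayleighQuotient _ hsymm]
  refine ciSup_le fun x ↦ ?_
  have hPx : 0 ≤ x.ofLp ⬝ᵥ P *ᵥ x.ofLp := by simpa using hP.dotProduct_mulVec_nonneg x.ofLp
  have hPRx : x.ofLp ⬝ᵥ P *ᵥ x.ofLp ≤ x.ofLp ⬝ᵥ R *ᵥ x.ofLp := by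
    simpa [sub_mulVec, dotProduct_sub] using hPR.dotProduct_mulVec_nonneg x.ofLp
  have hR := (le_abs_self _).trans ((toEuclideanCLM (𝕜 := ℝ) R).rayleighQuotient_le_norm x)
  rw [ContinuousLinearMap.rayleighQuotient, hquad] at hR ⊢
  rw [abs_of_nonneg (by positivity)]
  exact (by gcongr : _ ≤ _).trans hR

open scoped Matrix.Norms.L2Operator in
/-- The spectral norm of a congruence plus a perturbation. -/
lemma opNorm_transpose_mul_mul_add_le {n : ℕ} (A P Q : Matrix (Fin n) (Fin n) ℝ) :
    opNorm (Aᵀ * P * A + Q) ≤ opNorm A ^ 2 * opNorm P + opNorm Q := by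
  simp only [opNorm, l2_opNorm_toEuclideanCLM]
  have hAt : ‖Aᵀ‖ = ‖A‖ := by
    rw [← conjTranspose_eq_transpose_of_trivial, l2_opNorm_conjTranspose]
  calc ‖Aᵀ * P * A + Q‖ ≤ ‖Aᵀ‖ * ‖P‖ * ‖A‖ + ‖Q‖ := by
        grw [norm_add_le, norm_mul_le, norm_mul_le]
    _ = ‖A‖ ^ 2 * ‖P‖ + ‖Q‖ := by rw [hAt]; ring

/-- **Upper bound on the Riccati solution for a contractive `A`.**
If `‖A‖ < 1`, `Q` is symmetric, `P` is symmetric positive semidefinite with `BᵀPB`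
invertible and `P` satisfies the discrete algebraic Riccati equation
`P = AᵀPA − AᵀPB(BᵀPB)⁻¹BᵀPA + Q`, then `P ⪯ AᵀPA + Q` and
`‖P‖ ≤ ‖Q‖ / (1 − ‖A‖²)` (operator norms). -/
theorem riccati_norm_upper_bound {n d : ℕ}
    (A P Q : Matrix (Fin n) (Fin n) ℝ) (B : Matrix (Fin n) (Fin d) ℝ)
    (hA : opNorm A < 1) (hQ : Q.IsSymm) (hP : P.PosSemidef)
    (hBPB : IsUnit (Bᵀ * P * B))
    (hric : P = Aᵀ * P * A - Aᵀ * P * B * (Bᵀ * P * B)⁻¹ * Bᵀ * P * A + Q) :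
    (Aᵀ * P * A + Q - P).PosSemidef ∧ opNorm P ≤ opNorm Q / (1 - opNorm A ^ 2) := by
  have hle : (Aᵀ * P * A + Q - P).PosSemidef := by
    have hPt : Pᵀ = P := by simpa using hP.1.eq
    have hM : (Bᵀ * P * B).PosSemidef := by simpa using hP.conjTranspose_mul_mul_same B
    have key : Aᵀ * P * A + Q - P
        = (Bᵀ * P * A)ᴴ * (Bᵀ * P * B)⁻¹ * (Bᵀ * P * A) := by
      rw [sub_eq_iff_eq_add]
      nth_rw 5 [hric]
      simp only [conjTranspose_eq_transpose_of_trivial, transpose_mul, transpose_transpose, hPt,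
        Matrix.mul_assoc]
      abel
    rw [key]
    exact hM.inv.conjTranspose_mul_mul_same _
  refine ⟨hle, ?_⟩
  have hA0 : 0 ≤ opNorm A := norm_nonneg _
  have hbound := (opNorm_le_opNorm_of_posSemidef_sub hP hle).trans
    (opNorm_transpose_mul_mul_add_le A P Q)
  rw [le_div_iff₀ (by nlinarith)]
  linarith
end

section
/- Let P_E and P_F be orthogonal projection matrices in ℝ^{n×n} (symmetric and idempotent), and let τ, γ ∈ (0,1) with τ + γ < 1. Define A_i := τ P_E + γ I_n and A_j := τ P_F + γ I_n, and let P_i := Σ_{k=0}^{∞} A_i^{2k} and P_j := Σ_{k=0}^{∞} A_j^{2k} (both series converge since ‖A_i‖, ‖A_j‖ ≤ τ + γ < 1). Then P_i − P_j = c (P_E − P_F) for a scalar c ≥ 2γτ/(1−γ²)², and in particular ‖P_i − P_j‖_F ≥ (2γτ/(1−γ²)²) ‖P_E − P_F‖_F. -/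
open Matrix

/-- The Frobenius norm `‖M‖_F = √Tr(MᵀM)` of a real matrix. -/
noncomputable def frobNorm {m p : ℕ} (M : Matrix (Fin m) (Fin p) ℝ) : ℝ :=
  Real.sqrt ((Mᵀ * M).trace)

theorem frobNorm_smul {m p : ℕ} (c : ℝ) (M : Matrix (Fin m) (Fin p) ℝ) :
    frobNorm (c • M) = |c| * frobNorm M := by
  have h : ((c • M)ᵀ * (c • M)).trace = c ^ 2 * (Mᵀ * M).trace := by
    simp only [Matrix.transpose_smul, Matrix.smul_mul, Matrix.mul_smul, Matrix.trace_smul,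
      smul_eq_mul]
    ring
  rw [frobNorm, frobNorm, h, Real.sqrt_mul (sq_nonneg c), Real.sqrt_sq_eq_abs]

theorem IsIdempotentElem.smul_add_smul_one_pow {R A : Type*} [CommRing R] [Ring A] [Algebra R A]
    {p : A} (hp : IsIdempotentElem p) (a b : R) (k : ℕ) :
    (a • p + b • (1 : A)) ^ k = ((a + b) ^ k - b ^ k) • p + b ^ k • (1 : A) := by
  induction k with
  | zero => simp
  | succ k ih =>
    rw [pow_succ, ih]
    simp only [add_mul, mul_add, smul_mul_smul_comm, hp.eq, mul_one, one_mul]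
    module

theorem IsIdempotentElem.hasSum_smul_add_smul_one_pow_two_mul {A : Type*} [Ring A] [Algebra ℝ A]
    [TopologicalSpace A] [ContinuousAdd A] [ContinuousSMul ℝ A]
    {p : A} (hp : IsIdempotentElem p) {a b : ℝ} (hb : |b| < 1) (hab : |a + b| < 1) :
    HasSum (fun k : ℕ => (a • p + b • (1 : A)) ^ (2 * k))
      (((1 - (a + b) ^ 2)⁻¹ - (1 - b ^ 2)⁻¹) • p + (1 - b ^ 2)⁻¹ • (1 : A)) := by
  have key {x : ℝ} (hx : |x| < 1) : HasSum (fun k : ℕ => x ^ (2 * k)) (1 - x ^ 2)⁻¹ := by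
    simp only [pow_mul]
    exact hasSum_geometric_of_lt_one (sq_nonneg x) ((sq_lt_one_iff_abs_lt_one x).2 hx)
  simp only [hp.smul_add_smul_one_pow]
  exact (((key hab).sub (key hb)).smul_const p).add ((key hb).smul_const 1)

theorem two_mul_mul_div_le_inv_sub_inv {τ γ : ℝ} (hτ : 0 ≤ τ) (hγ : 0 ≤ γ) (hτγ : τ + γ < 1) :
    2 * γ * τ / (1 - γ ^ 2) ^ 2 ≤ (1 - (τ + γ) ^ 2)⁻¹ - (1 - γ ^ 2)⁻¹ := by
  have h1 : 0 < 1 - (τ + γ) ^ 2 := by nlinarith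
  have h2 : 0 < 1 - γ ^ 2 := by nlinarith
  have h3 : (1 - (τ + γ) ^ 2)⁻¹ - (1 - γ ^ 2)⁻¹ =
      (2 * γ * τ + τ ^ 2) / ((1 - (τ + γ) ^ 2) * (1 - γ ^ 2)) := by
    field_simp
    ring
  rw [h3, sq (1 - γ ^ 2)]
  gcongr <;> nlinarith

/-- **Separation of Lyapunov solutions for shifted projections.**
Let `P_E, P_F` be orthogonal projections, `τ, γ ∈ (0,1)` with `τ + γ < 1`, and
`A_i = τ P_E + γ I`, `A_j = τ P_F + γ I`.  Then the series `P_i = Σ_k A_i^{2k}` and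
`P_j = Σ_k A_j^{2k}` converge, `P_i − P_j = c (P_E − P_F)` for some scalar
`c ≥ 2γτ/(1−γ²)²`, and in particular
`‖P_i − P_j‖_F ≥ (2γτ/(1−γ²)²) ‖P_E − P_F‖_F`. -/
theorem lyapunov_projection_separation {n : ℕ}
    (PE PF : Matrix (Fin n) (Fin n) ℝ)
    (hPEs : PE.IsSymm) (hPE : PE * PE = PE) (hPFs : PF.IsSymm) (hPF : PF * PF = PF)
    (τ γ : ℝ) (hτ : τ ∈ Set.Ioo (0 : ℝ) 1) (hγ : γ ∈ Set.Ioo (0 : ℝ) 1)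
    (hτγ : τ + γ < 1) :
    ∃ Pi Pj : Matrix (Fin n) (Fin n) ℝ,
      HasSum (fun k : ℕ => (τ • PE + γ • (1 : Matrix (Fin n) (Fin n) ℝ)) ^ (2 * k)) Pi ∧
      HasSum (fun k : ℕ => (τ • PF + γ • (1 : Matrix (Fin n) (Fin n) ℝ)) ^ (2 * k)) Pj ∧
      (∃ c : ℝ, 2 * γ * τ / (1 - γ ^ 2) ^ 2 ≤ c ∧ Pi - Pj = c • (PE - PF)) ∧
      2 * γ * τ / (1 - γ ^ 2) ^ 2 * frobNorm (PE - PF) ≤ frobNorm (Pi - Pj) := by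
  have hγ1 : |γ| < 1 := by rw [abs_of_pos hγ.1]; exact hγ.2
  have hτγ1 : |τ + γ| < 1 := by rw [abs_of_pos (add_pos hτ.1 hγ.1)]; exact hτγ
  have hc := two_mul_mul_div_le_inv_sub_inv hτ.1.le hγ.1.le hτγ
  set c := (1 - (τ + γ) ^ 2)⁻¹ - (1 - γ ^ 2)⁻¹ with hcdef
  have hsub : (c • PE + (1 - γ ^ 2)⁻¹ • (1 : Matrix (Fin n) (Fin n) ℝ)) -
      (c • PF + (1 - γ ^ 2)⁻¹ • (1 : Matrix (Fin n) (Fin n) ℝ)) = c • (PE - PF) := by module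
  refine ⟨_, _, IsIdempotentElem.hasSum_smul_add_smul_one_pow_two_mul hPE hγ1 hτγ1,
    IsIdempotentElem.hasSum_smul_add_smul_one_pow_two_mul hPF hγ1 hτγ1, ⟨c, hc, hsub⟩, ?_⟩
  rw [← hcdef, hsub, frobNorm_smul]
  exact mul_le_mul_of_nonneg_right (hc.trans (le_abs_self c)) (Real.sqrt_nonneg _)
end
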